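/- Every closed term of primitive recursive arithmetic reduces to a numeral in finitely many steps under innermost application of the defining recursion equations. -/

import Mathlib

/-- Terms of primitive recursive arithmetic: variables (used only in defining
equations), the constant 0, successor `+1`, and applications of primitive
recursively defined function symbols (numbered in their order of definition). -/
inductive TmP where
  | var : ℕ → TmP
  | zero : TmP
  | succ : TmP → TmP
  | app : ℕ → List TmP → TmP

/-- Substitution of terms for variables in a term. -/
def TmP.subst (σ : ℕ → TmP) : TmP → TmP
  | .var n => σ n
  | .zero => .zero
  | .succ t => .succ (t.subst σ)
  | .app k ts => .app k (ts.attach.map fun t => t.1.subst σ)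
decreasing_by
  all_goals first
    | decreasing_tactic
    | (simp_wf
       have := List.sizeOf_lt_of_mem t.2
       omega)

/-- The numeral corresponding to a natural number: 0, 0+1, (0+1)+1, …. -/
def TmP.numeral : ℕ → TmP
  | 0 => .zero
  | n + 1 => .succ (numeral n)

/-- A primitive recursive definition of a function symbol `φ` of arity `arity + 1`:
`φ(0, b₁,…,bₙ) = base` where in `base` the variable `i` stands for `b_{i+1}`, and
`φ(a+1, b₁,…,bₙ) = step` where in `step` variable `0` stands for `a`, variable `1`
stands for the recursion value `φ(a, b₁,…,bₙ)`, and variable `i+2` stands for `b_{i+1}`. -/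
structure PRDefn where
  arity : ℕ
  base : TmP
  step : TmP

/-- Well-formedness of a term relative to an environment `E` of primitive recursive
definitions: all function symbols have index `< fb`, are applied to the correct
number of arguments, and all variables are `< vb`. -/
inductive TmOk (E : List PRDefn) (fb vb : ℕ) : TmP → Prop where
  | var {n : ℕ} : n < vb → TmOk E fb vb (.var n)
  | zero : TmOk E fb vb .zero
  | succ {t : TmP} : TmOk E fb vb t → TmOk E fb vb (.succ t)
  | app {k : ℕ} {ts : List TmP} (hk : k < fb) (hkE : k < E.length) :
      ts.length = (E.get ⟨k, hkE⟩).arity + 1 →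
      (∀ t ∈ ts, TmOk E fb vb t) → TmOk E fb vb (.app k ts)

/-- A well-formed environment: the defining terms of the `k`-th function symbol use
only function symbols introduced earlier (index `< k`) and only the allowed variables. -/
def EnvWF (E : List PRDefn) : Prop :=
  ∀ (k : ℕ) (hk : k < E.length),
    TmOk E k (E.get ⟨k, hk⟩).arity (E.get ⟨k, hk⟩).base ∧
    TmOk E k ((E.get ⟨k, hk⟩).arity + 2) (E.get ⟨k, hk⟩).step

/-- A closed term: a well-formed term containing no variables (variable bound 0). -/
def ClosedTm (E : List PRDefn) (t : TmP) : Prop :=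
  TmOk E E.length 0 t

/-- One innermost reduction step: a closed subterm `φ(𝔷, 𝔷₁,…,𝔷ₙ)` all of whose
arguments are numerals (hence an innermost non-numeral closed subterm) is replaced
by the corresponding right-hand side of the defining equations of `φ`, with the
numerals substituted for the variables. -/
inductive Step (E : List PRDefn) : TmP → TmP → Prop where
  | base (k : ℕ) (hk : k < E.length) (zs : List ℕ)
      (hlen : zs.length = (E.get ⟨k, hk⟩).arity) :
      Step E (.app k (TmP.numeral 0 :: zs.map TmP.numeral))
        ((E.get ⟨k, hk⟩).base.subst fun i => (zs.map TmP.numeral).getD i .zero)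
  | step (k : ℕ) (hk : k < E.length) (m : ℕ) (zs : List ℕ)
      (hlen : zs.length = (E.get ⟨k, hk⟩).arity) :
      Step E (.app k (TmP.numeral (m + 1) :: zs.map TmP.numeral))
        ((E.get ⟨k, hk⟩).step.subst fun i =>
          (TmP.numeral m :: TmP.app k (TmP.numeral m :: zs.map TmP.numeral) ::
            zs.map TmP.numeral).getD i .zero)
  | congSucc {t t' : TmP} : Step E t t' → Step E (.succ t) (.succ t')
  | congApp {t t' : TmP} (k : ℕ) (ts us : List TmP) :
      Step E t t' → Step E (.app k (ts ++ t :: us)) (.app k (ts ++ t' :: us))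

/-- A term is reducible if it reduces to some numeral. -/
def Reducible (E : List PRDefn) (t : TmP) : Prop :=
  ∃ n : ℕ, Relation.ReflTransGen (Step E) t (TmP.numeral n)

theorem TmP.subst_app (σ : ℕ → TmP) (k : ℕ) (ts : List TmP) :
    (TmP.app k ts).subst σ = .app k (ts.map (TmP.subst σ)) := by
  rw [TmP.subst]
  simp

theorem TmOk.subst_var {E : List PRDefn} {fb vb : ℕ} {t : TmP} (ht : TmOk E fb vb t) :
    t.subst TmP.var = t := by
  induction ht with
  | var h => rw [TmP.subst]
  | zero => rw [TmP.subst]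
  | succ _ ih => rw [TmP.subst, ih]
  | app _ _ _ _ ih =>
    rw [TmP.subst_app]
    congr 1
    exact (List.map_congr_left ih).trans (List.map_id _)

namespace Reducible

variable {E : List PRDefn}

theorem numeral (n : ℕ) : Reducible E (TmP.numeral n) := ⟨n, .refl⟩

theorem of_reduces {t u : TmP} (h : Relation.ReflTransGen (Step E) t u) :
    Reducible E u → Reducible E t := fun ⟨n, hn⟩ => ⟨n, h.trans hn⟩

theorem succ {t : TmP} : Reducible E t → Reducible E (.succ t) :=
  fun ⟨n, hn⟩ => ⟨n + 1, hn.lift TmP.succ fun _ _ => Step.congSucc⟩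

/-- The arguments of an application can be reduced to numerals from left to right. -/
theorem exists_args (k : ℕ) (ts : List TmP) (hts : ∀ t ∈ ts, Reducible E t) (pre : List TmP) :
    ∃ zs : List ℕ, zs.length = ts.length ∧
      Relation.ReflTransGen (Step E) (.app k (pre ++ ts))
        (.app k (pre ++ zs.map TmP.numeral)) := by
  induction ts generalizing pre with
  | nil => exact ⟨[], rfl, .refl⟩
  | cons t ts ih =>
    obtain ⟨n, hn⟩ := hts t (by simp)
    obtain ⟨zs, hlen, hzs⟩ :=
      ih (fun u hu => hts u (List.mem_cons_of_mem _ hu)) (pre ++ [TmP.numeral n])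
    refine ⟨n :: zs, by simp [hlen], ?_⟩
    have h := hn.lift (fun u => TmP.app k (pre ++ u :: ts))
      fun _ _ => Step.congApp (E := E) k pre ts
    exact h.trans (by simpa using hzs)

/-- If all function symbols below `fb` are reducible on numerals, then a term over these symbols
is reducible under every substitution of reducible terms for its variables. -/
theorem subst {fb vb : ℕ}
    (hfb : ∀ (k : ℕ) (hk : k < E.length), k < fb → ∀ (m : ℕ) (zs : List ℕ),
      zs.length = (E.get ⟨k, hk⟩).arity →
      Reducible E (.app k (TmP.numeral m :: zs.map TmP.numeral)))
    {t : TmP} (ht : TmOk E fb vb t) (σ : ℕ → TmP) (hσ : ∀ i < vb, Reducible E (σ i)) :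
    Reducible E (t.subst σ) := by
  induction ht with
  | var h => rw [TmP.subst]; exact hσ _ h
  | zero => rw [TmP.subst]; exact numeral 0
  | succ _ ih => rw [TmP.subst]; exact ih.succ
  | @app k ts hk hkE hlen _ ih =>
    rw [TmP.subst_app]
    obtain ⟨zs, hzs, hred⟩ := exists_args (E := E) k (ts.map (TmP.subst σ)) (by simpa using ih) []
    refine of_reduces hred ?_
    rw [List.length_map, hlen] at hzs
    cases zs with
    | nil => simp at hzs
    | cons m zs => exact hfb k hkE hk m zs (by simpa using hzs)

theorem getD_numerals (zs : List ℕ) (i : ℕ) :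
    Reducible E ((zs.map TmP.numeral).getD i .zero) := by
  change Reducible E ((zs.map TmP.numeral).getD i (TmP.numeral 0))
  rw [List.getD_map]
  exact numeral _

/-- Every function symbol applied to numerals is reducible. -/
theorem app_numerals (hE : EnvWF E) (k : ℕ) (hk : k < E.length) (m : ℕ) (zs : List ℕ)
    (hzs : zs.length = (E.get ⟨k, hk⟩).arity) :
    Reducible E (.app k (TmP.numeral m :: zs.map TmP.numeral)) := by
  induction k using Nat.strong_induction_on generalizing m zs with
  | _ k ihk =>
    have hfb : ∀ (j : ℕ) (hj : j < E.length), j < k → ∀ (m : ℕ) (zs : List ℕ),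
        zs.length = (E.get ⟨j, hj⟩).arity →
        Reducible E (.app j (TmP.numeral m :: zs.map TmP.numeral)) :=
      fun j hj hjk m zs h => ihk j hjk hj m zs h
    induction m with
    | zero =>
      exact of_reduces (.single (.base k hk zs hzs))
        (subst hfb (hE k hk).1 _ fun i _ => getD_numerals zs i)
    | succ m ihm =>
      refine of_reduces (.single (.step k hk m zs hzs)) (subst hfb (hE k hk).2 _ fun i _ => ?_)
      match i with
      | 0 => exact numeral m
      | 1 => exact ihm
      | i + 2 => exact getD_numerals zs i

end Reducible

/-- Every closed term of primitive recursive arithmetic reduces to a numeral in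
finitely many steps under innermost application of the defining recursion
equations. -/
theorem closed_term_reduces_to_numeral (E : List PRDefn) (hE : EnvWF E)
    (t : TmP) (ht : ClosedTm E t) :
    ∃ n : ℕ, Relation.ReflTransGen (Step E) t (TmP.numeral n) := by
  have h := Reducible.subst (fun k hk _ => Reducible.app_numerals hE k hk) ht TmP.var
    fun i hi => absurd hi (Nat.not_lt_zero i)
  rwa [ht.subst_var] at h
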